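/- For any prior parameters μ₀ ∈ ℝ, κ₀,α₀,β₀ > 0 and any data x₁,…,x_n ∈ ℝ, the posterior predictive probability has the closed form ∫₀^∞∫_ℝ ∏_{k=1}^n N(x_k|μ,λ⁻¹)·NG(μ,λ|μ₀,κ₀,α₀,β₀) dμ dλ = [Γ(α₀+n/2)·β₀^{α₀}·(2π)^{−n/2}·κ₀^{1/2}] / [Γ(α₀)·β_n^{α₀+n/2}·(κ₀+n)^{1/2}], where x̄ is the sample mean of x₁,…,x_n and β_n = β₀ + (1/2)Σ_k(x_k−x̄)² + κ₀ n(x̄−μ₀)²/(2(κ₀+n)). (Closed form of the Gaussian–Gaussian-gamma posterior predictive, Eq. (10).) -/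

import Mathlib

open MeasureTheory ProbabilityTheory Real Filter Finset

noncomputable section

/-- Gaussian density `N(ω|μ,λ⁻¹)` with mean `μ` and precision `lam`. -/
def gaussPDF (μ lam ω : ℝ) : ℝ :=
  Real.sqrt (lam / (2 * Real.pi)) * Real.exp (-(lam * (ω - μ) ^ 2) / 2)

/-- Joint Gaussian density of a vector of observations. -/
def gaussVecPDF {n : ℕ} (μ lam : ℝ) (x : Fin n → ℝ) : ℝ :=
  ∏ k, gaussPDF μ lam (x k)

/-- Parameters of a Gaussian-gamma distribution. -/
structure GG where
  μ : ℝ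
  κ : ℝ
  α : ℝ
  β : ℝ

/-- Gaussian-gamma density `NG(x, lam | φ)`. -/
def ngPDF (φ : GG) (x lam : ℝ) : ℝ :=
  (φ.β ^ φ.α * Real.sqrt φ.κ / (Real.Gamma φ.α * Real.sqrt (2 * Real.pi))) *
    lam ^ (φ.α - 1 / 2) * Real.exp (-φ.β * lam) *
    Real.exp (-(φ.κ * lam * (x - φ.μ) ^ 2) / 2)

/-- Sample mean. -/
def sampleMean {n : ℕ} (x : Fin n → ℝ) : ℝ := (∑ k, x k) / n

/-- Gaussian-gamma parameter update with data `x`. -/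
def updateGG (φ : GG) {n : ℕ} (x : Fin n → ℝ) : GG where
  μ := (φ.κ * φ.μ + n * sampleMean x) / (φ.κ + n)
  κ := φ.κ + n
  α := φ.α + n / 2
  β := φ.β + (∑ k, (x k - sampleMean x) ^ 2) / 2 +
        φ.κ * n * (sampleMean x - φ.μ) ^ 2 / (2 * (φ.κ + n))

/-- The noninformative prior `φ₀ = (0,1,1,1)`. -/
def phi0 : GG := ⟨0, 1, 1, 1⟩

/-- Posterior predictive probability `P̂(x | φ)`. -/
def postPred (φ : GG) {n : ℕ} (x : Fin n → ℝ) : ℝ :=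
  ∫ lam in Set.Ioi (0 : ℝ), (∫ m : ℝ, gaussVecPDF m lam x * ngPDF φ m lam)

/-- One-step posterior predictive density `P̂(x | w₁,…,w_n)` under the noninformative prior. -/
def osPred {n : ℕ} (w : Fin n → ℝ) (x : ℝ) : ℝ :=
  postPred phi0 (Fin.snoc w x) / postPred phi0 w

/-- Kullback–Leibler divergence between densities on `ℝ`. -/
def klDivR (p q : ℝ → ℝ) : ℝ := ∫ x : ℝ, p x * Real.log (p x / q x)


theorem gaussVecPDF_eq {n : ℕ} (m lam : ℝ) (x : Fin n → ℝ) :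
    gaussVecPDF m lam x =
      Real.sqrt (lam / (2 * Real.pi)) ^ n * Real.exp (-(lam * ∑ k, (x k - m) ^ 2) / 2) := by
  simp only [gaussVecPDF, gaussPDF, Finset.prod_mul_distrib, Finset.prod_const, Finset.card_univ,
    Fintype.card_fin, ← Real.exp_sum, ← Finset.sum_div, Finset.sum_neg_distrib, Finset.mul_sum]

theorem card_mul_sampleMean {n : ℕ} (x : Fin n → ℝ) : n * sampleMean x = ∑ k, x k := by
  rcases eq_or_ne n 0 with rfl | hn
  · simp
  · have : (n : ℝ) ≠ 0 := Nat.cast_ne_zero.mpr hn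
    unfold sampleMean
    field_simp

/-- Decomposition of the squared deviations from `m` into those from the sample mean. -/
theorem sum_sub_sq_eq {n : ℕ} (x : Fin n → ℝ) (m : ℝ) :
    ∑ k, (x k - m) ^ 2 =
      ∑ k, (x k - sampleMean x) ^ 2 + n * (sampleMean x - m) ^ 2 := by
  have h : ∀ c : ℝ, ∑ k, (x k - c) ^ 2 = ∑ k, x k ^ 2 - 2 * c * ∑ k, x k + n * c ^ 2 := by
    intro c
    simp only [sub_sq, Finset.sum_add_distrib, Finset.sum_sub_distrib, Finset.sum_const,
      Finset.card_univ, Fintype.card_fin, nsmul_eq_mul, Finset.mul_sum]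
    congr 2
    exact Finset.sum_congr rfl fun k _ => by ring
  rw [h, h]
  linear_combination 2 * (m - sampleMean x) * card_mul_sampleMean x

/-- Completing the square in the exponent of likelihood times prior. -/
theorem posterior_exponent_eq (φ : GG) (hκ : 0 < φ.κ) {n : ℕ} (x : Fin n → ℝ) (m : ℝ) :
    (∑ k, (x k - m) ^ 2) / 2 + φ.β + φ.κ * (m - φ.μ) ^ 2 / 2 =
      (updateGG φ x).β + (updateGG φ x).κ / 2 * (m - (updateGG φ x).μ) ^ 2 := by
  have : φ.κ + n ≠ 0 := by positivity
  rw [sum_sub_sq_eq]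
  simp only [updateGG]
  field_simp
  ring

theorem sqrt_div_two_pi_pow {lam : ℝ} (hl : 0 < lam) (n : ℕ) :
    Real.sqrt (lam / (2 * Real.pi)) ^ n =
      lam ^ ((n : ℝ) / 2) * (2 * Real.pi) ^ (-(n : ℝ) / 2) := by
  have hp : (0 : ℝ) < 2 * Real.pi := by positivity
  rw [Real.sqrt_eq_rpow, ← Real.rpow_natCast, ← Real.rpow_mul (by positivity),
    Real.div_rpow hl.le hp.le, neg_div, Real.rpow_neg hp.le, div_eq_mul_inv]
  ring_nf

theorem integral_exp_neg_mul_sub_sq (b c : ℝ) :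
    ∫ m : ℝ, Real.exp (-b * (m - c) ^ 2) = Real.sqrt (Real.pi / b) := by
  rw [integral_sub_right_eq_self (fun m : ℝ => Real.exp (-b * m ^ 2)) c, integral_gaussian]

/-- The likelihood times the prior, with the mean integrated out. -/
theorem integral_gaussVecPDF_mul_ngPDF (φ : GG) (hκ : 0 < φ.κ) {n : ℕ} (x : Fin n → ℝ)
    {lam : ℝ} (hl : 0 < lam) :
    ∫ m : ℝ, gaussVecPDF m lam x * ngPDF φ m lam =
      (φ.β ^ φ.α * Real.sqrt φ.κ * (2 * Real.pi) ^ (-(n : ℝ) / 2) /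
        (Real.Gamma φ.α * Real.sqrt (φ.κ + n))) *
        (lam ^ (φ.α + (n : ℝ) / 2 - 1) * Real.exp (-((updateGG φ x).β * lam))) := by
  have key : ∀ m : ℝ, gaussVecPDF m lam x * ngPDF φ m lam =
      (Real.sqrt (lam / (2 * Real.pi)) ^ n *
        (φ.β ^ φ.α * Real.sqrt φ.κ / (Real.Gamma φ.α * Real.sqrt (2 * Real.pi))) *
        lam ^ (φ.α - 1 / 2) * Real.exp (-((updateGG φ x).β * lam))) *
      Real.exp (-((φ.κ + n) * lam / 2) * (m - (updateGG φ x).μ) ^ 2) := by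
    intro m
    have hexp : Real.exp (-(lam * ∑ k, (x k - m) ^ 2) / 2) * Real.exp (-φ.β * lam) *
        Real.exp (-(φ.κ * lam * (m - φ.μ) ^ 2) / 2) =
        Real.exp (-((updateGG φ x).β * lam)) *
          Real.exp (-((φ.κ + n) * lam / 2) * (m - (updateGG φ x).μ) ^ 2) := by
      rw [← Real.exp_add, ← Real.exp_add, ← Real.exp_add]
      congr 1
      have h := posterior_exponent_eq φ hκ x m
      rw [show (updateGG φ x).κ = φ.κ + n from rfl] at h
      linear_combination -lam * h
    rw [gaussVecPDF_eq, ngPDF]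
    linear_combination Real.sqrt (lam / (2 * Real.pi)) ^ n *
      (φ.β ^ φ.α * Real.sqrt φ.κ / (Real.Gamma φ.α * Real.sqrt (2 * Real.pi))) *
      lam ^ (φ.α - 1 / 2) * hexp
  have hK : 0 < φ.κ + n := by positivity
  have hsqrt : Real.sqrt (Real.pi / ((φ.κ + n) * lam / 2)) =
      Real.sqrt (2 * Real.pi) / Real.sqrt (φ.κ + n) * lam ^ (-(1 / 2) : ℝ) := by
    rw [Real.rpow_neg hl.le, ← Real.sqrt_eq_rpow, ← Real.sqrt_div' _ hK.le,
      ← Real.sqrt_inv, ← Real.sqrt_mul (by positivity)]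
    congr 1
    field_simp
  have hpow : lam ^ (φ.α + (n : ℝ) / 2 - 1) =
      lam ^ ((n : ℝ) / 2) * lam ^ (φ.α - 1 / 2) * lam ^ (-(1 / 2) : ℝ) := by
    rw [← Real.rpow_add hl, ← Real.rpow_add hl]
    congr 1
    ring
  simp_rw [key]
  rw [integral_const_mul, integral_exp_neg_mul_sub_sq, hsqrt, sqrt_div_two_pi_pow hl, hpow]
  have h2 : Real.sqrt (2 * Real.pi) ≠ 0 := by positivity
  field_simp

/-- Closed form of the Gaussian–Gaussian-gamma posterior predictive distribution
(Eq. (10)). -/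
theorem postPred_closed_form
    (mu0 kappa0 alpha0 beta0 : ℝ) (hkappa : 0 < kappa0) (halpha : 0 < alpha0)
    (hbeta : 0 < beta0) (n : ℕ) (x : Fin n → ℝ) :
    postPred ⟨mu0, kappa0, alpha0, beta0⟩ x =
      Real.Gamma (alpha0 + (n : ℝ) / 2) * beta0 ^ alpha0 *
        (2 * Real.pi) ^ (-(n : ℝ) / 2) * kappa0 ^ ((1 : ℝ) / 2) /
      (Real.Gamma alpha0 *
        (beta0 + (∑ k, (x k - sampleMean x) ^ 2) / 2 +
          kappa0 * n * (sampleMean x - mu0) ^ 2 / (2 * (kappa0 + n)))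
            ^ (alpha0 + (n : ℝ) / 2) *
        (kappa0 + n) ^ ((1 : ℝ) / 2)) := by
  have hβ : 0 < (updateGG ⟨mu0, kappa0, alpha0, beta0⟩ x).β := by
    simp only [updateGG]
    have := Finset.sum_nonneg fun k (_ : k ∈ Finset.univ) => sq_nonneg (x k - sampleMean x)
    positivity
  rw [postPred, setIntegral_congr_fun measurableSet_Ioi fun lam hl =>
      integral_gaussVecPDF_mul_ngPDF ⟨mu0, kappa0, alpha0, beta0⟩ hkappa x hl,
    integral_const_mul, Real.integral_rpow_mul_exp_neg_mul_Ioi (by positivity) hβ,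
    one_div, Real.inv_rpow hβ.le]
  simp only [updateGG, Real.sqrt_eq_rpow]
  ring

end
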